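/- (Rohn) Let E ⊂ ℙ¹ × ℙ¹ be a nonsingular curve defined by an irreducible bihomogeneous form of bidegree (2,2) over an algebraically closed field of characteristic ≠ 2 (so E has genus 1). Then there exists an automorphism f of ℙ¹, acting on the first factor, such that the new embedding E ⊂ ℙ¹ × ℙ¹ → ℙ¹ × ℙ¹ given by (p,q) ↦ (f(p), q) is symmetric, i.e., its image contains (q, p) whenever it contains (p, q). -/

import Mathlib

namespace RQS

open MvPolynomial


open MvPolynomial

variable (K : Type) [Field K]

/-- Projective n-space modelled as the projectivization of `Fin n → K`
(so `PP K (n+1)` is ℙⁿ). -/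
abbrev PP (n : ℕ) : Type := Projectivization K (Fin n → K)

variable {K}

/-- Vanishing of a (homogeneous) polynomial at a projective point. -/
def vanishes {n : ℕ} (p : MvPolynomial (Fin n) K) (x : PP K n) : Prop :=
  ∀ (v : Fin n → K) (h : v ≠ 0), Projectivization.mk K v h = x → eval v p = 0

/-- Projective zero locus of a set of polynomials. -/
def zeroLocus {n : ℕ} (S : Set (MvPolynomial (Fin n) K)) : Set (PP K n) :=
  {x | ∀ p ∈ S, vanishes p x}

/-- Zariski closed subsets of projective space. -/
def ZClosed {n : ℕ} (X : Set (PP K n)) : Prop :=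
  ∃ S : Set (MvPolynomial (Fin n) K), (∀ p ∈ S, ∃ d, p.IsHomogeneous d) ∧ X = zeroLocus S

/-- Irreducibility with respect to the Zariski topology. -/
def ZIrred {n : ℕ} (X : Set (PP K n)) : Prop :=
  X.Nonempty ∧ ∀ A B : Set (PP K n), ZClosed A → ZClosed B → X ⊆ A ∪ B → X ⊆ A ∨ X ⊆ B

/-- `X` contains a chain of closed irreducible subsets of length `d+1`. -/
def dimGE {n : ℕ} (X : Set (PP K n)) (d : ℕ) : Prop :=
  ∃ f : Fin (d + 1) → Set (PP K n),
    (∀ i, ZClosed (f i) ∧ ZIrred (f i) ∧ f i ⊆ X) ∧ StrictMono f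

/-- `X` has (Krull) dimension exactly `d`. -/
def HasDim {n : ℕ} (X : Set (PP K n)) (d : ℕ) : Prop := dimGE X d ∧ ¬ dimGE X (d + 1)

/-- The hyperplane with coefficient vector `φ`. -/
def hyp {n : ℕ} (φ : Fin n → K) : Set (PP K n) :=
  {x | ∀ (v : Fin n → K) (h : v ≠ 0), Projectivization.mk K v h = x → ∑ i, φ i * v i = 0}

/-- Degree of a (reduced) curve: every hyperplane not containing it meets it in at most `d`
points, and some hyperplane meets it in exactly `d` points. -/
def HasCurveDeg {n : ℕ} (X : Set (PP K n)) (d : ℕ) : Prop :=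
  (∀ φ : Fin n → K, φ ≠ 0 → ¬ X ⊆ hyp φ →
    (X ∩ hyp φ).Finite ∧ (X ∩ hyp φ).ncard ≤ d) ∧
  (∃ φ : Fin n → K, φ ≠ 0 ∧ ¬ X ⊆ hyp φ ∧ (X ∩ hyp φ).ncard = d)

/-- An irreducible projective curve of degree `d`. -/
def IsCurveOfDeg {n : ℕ} (X : Set (PP K n)) (d : ℕ) : Prop :=
  ZClosed X ∧ ZIrred X ∧ HasDim X 1 ∧ HasCurveDeg X d

/-- A property holds at a general point of `S`. -/
def GenericPts {n : ℕ} (S : Set (PP K n)) (Q : PP K n → Prop) : Prop :=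
  ∃ T : Set (PP K n), ZClosed T ∧ ¬ S ⊆ T ∧ ∀ p ∈ S, p ∉ T → Q p

/-! ### Plücker coordinates: `p₁₂,p₁₃,p₁₄,p₂₃,p₂₄,p₃₄` indexed by `0,…,5` -/

/-- Plücker coordinates of the line through `u` and `v`, i.e. the bivector `u ∧ v`. -/
def plucker (u v : Fin 4 → K) : Fin 6 → K :=
  ![u 0 * v 1 - u 1 * v 0, u 0 * v 2 - u 2 * v 0, u 0 * v 3 - u 3 * v 0,
    u 1 * v 2 - u 2 * v 1, u 1 * v 3 - u 3 * v 1, u 2 * v 3 - u 3 * v 2]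

/-- The Plücker quadric `p₁₂p₃₄ - p₁₃p₂₄ + p₁₄p₂₃`, i.e. `½ w ∧ w`. -/
def plQuad (w : Fin 6 → K) : K := w 0 * w 5 - w 1 * w 4 + w 2 * w 3

/-- The wedge pairing `w ∧ z ∈ Λ⁴V ≅ K` of two bivectors. -/
def plPair (w z : Fin 6 → K) : K :=
  w 0 * z 5 + w 5 * z 0 - w 1 * z 4 - w 4 * z 1 + w 2 * z 3 + w 3 * z 2

/-- The wedge `w ∧ v ∈ Λ³V ≅ V*` of a bivector `w` with a vector `v`;
`w ∧ v = 0` expresses that the point `v̄` lies on the line `w̄`. -/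
def wedgePt (w : Fin 6 → K) (v : Fin 4 → K) : Fin 4 → K :=
  ![w 0 * v 2 - w 1 * v 1 + w 3 * v 0,
    w 0 * v 3 - w 2 * v 1 + w 4 * v 0,
    w 1 * v 3 - w 2 * v 2 + w 5 * v 0,
    w 3 * v 3 - w 4 * v 2 + w 5 * v 1]

/-- The set of points of ℙ³ on the line with Plücker vector `w`. -/
def lineOfRep (w : Fin 6 → K) : Set (PP K 4) :=
  {p | ∀ (v : Fin 4 → K) (h : v ≠ 0), Projectivization.mk K v h = p → wedgePt w v = 0}

/-- `w` represents a line of ℙ³: it is nonzero and decomposable. -/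
def IsLineRep (w : Fin 6 → K) : Prop := w ≠ 0 ∧ plQuad w = 0

variable (K) in
/-- The Grassmannian `Gr(2,4) ⊂ ℙ⁵` of lines in ℙ³. -/
def grass : Set (PP K 6) :=
  {x | ∃ (w : Fin 6 → K) (h : w ≠ 0), Projectivization.mk K w h = x ∧ plQuad w = 0}

/-- The line in ℙ³ corresponding to a point `x` of the Grassmannian. -/
def lineOf (x : PP K 6) : Set (PP K 4) :=
  {p | ∀ (w : Fin 6 → K) (h : w ≠ 0), Projectivization.mk K w h = x → p ∈ lineOfRep w}

/-- The set of (Grassmann points of) lines contained in a surface `S ⊂ ℙ³`. -/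
def linesOf (S : Set (PP K 4)) : Set (PP K 6) :=
  {x | x ∈ grass K ∧ lineOf x ⊆ S}

/-- A ruled surface: an irreducible closed surface which is a union of lines. -/
def IsRuled (S : Set (PP K 4)) : Prop :=
  ZClosed S ∧ ZIrred S ∧ HasDim S 2 ∧ ∀ p ∈ S, ∃ x ∈ linesOf S, p ∈ lineOf x

/-- Degree of a surface in ℙ³ via intersections with lines. -/
def HasSurfDeg (S : Set (PP K 4)) (d : ℕ) : Prop :=
  (∀ w : Fin 6 → K, IsLineRep w → ¬ lineOfRep w ⊆ S →
    (S ∩ lineOfRep w).Finite ∧ (S ∩ lineOfRep w).ncard ≤ d) ∧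
  (∃ w : Fin 6 → K, IsLineRep w ∧ ¬ lineOfRep w ⊆ S ∧ (S ∩ lineOfRep w).ncard = d)

/-- A cone: all lines of `S` pass through a common point. -/
def IsCone (S : Set (PP K 4)) : Prop :=
  ∃ p : PP K 4, ∀ x ∈ linesOf S, p ∈ lineOf x

/-- `σ₂(p₀)`: the 2-plane in the Grassmannian of all lines through `p₀`. -/
def sigma2 (p₀ : PP K 4) : Set (PP K 6) := {x | x ∈ grass K ∧ p₀ ∈ lineOf x}

/-- The projective tangent space `T_{Gr,x₀}` of the Plücker quadric at `x₀`,
namely the hyperplane `{z̄ : w₀ ∧ z = 0}`. -/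
def tangentGr (x₀ : PP K 6) : Set (PP K 6) :=
  {x | ∀ (w : Fin 6 → K) (h : w ≠ 0), Projectivization.mk K w h = x →
    ∀ (w₀ : Fin 6 → K) (h₀ : w₀ ≠ 0), Projectivization.mk K w₀ h₀ = x₀ → plPair w₀ w = 0}

/-- The linear span of (the representatives of) a subset of projective space. -/
def spanOfSet {n : ℕ} (X : Set (PP K n)) : Submodule K (Fin n → K) :=
  Submodule.span K {v | ∃ h : v ≠ 0, Projectivization.mk K v h ∈ X}

/-- The projective subspace associated to a linear subspace. -/
def projSub {n : ℕ} (U : Submodule K (Fin n → K)) : Set (PP K n) :=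
  {x | ∀ (v : Fin n → K) (h : v ≠ 0), Projectivization.mk K v h = x → v ∈ U}

/-- `P(C)`: the smallest projective subspace containing `C`. -/
def projSpanOf {n : ℕ} (X : Set (PP K n)) : Set (PP K n) := projSub (spanOfSet X)

/-! ### Smoothness via Jacobian criteria -/

/-- The homogeneous polynomials vanishing on `X`. -/
def homIdeal {n : ℕ} (X : Set (PP K n)) : Set (MvPolynomial (Fin n) K) :=
  {p | (∃ d, p.IsHomogeneous d) ∧ ∀ x ∈ X, vanishes p x}

/-- The span of the gradients at `v` of all homogeneous polynomials vanishing on `X`. -/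
def gradSpan {n : ℕ} (X : Set (PP K n)) (v : Fin n → K) : Submodule K (Fin n → K) :=
  Submodule.span K
    {g | ∃ p ∈ homIdeal X, g = fun i => eval v (pderiv i p)}

/-- Smooth point of a projective *curve* `X ⊂ ℙ(Kⁿ)` (Jacobian criterion:
the affine cone over `X` has a 2-dimensional tangent space there). -/
def CurveSmoothPt {n : ℕ} (X : Set (PP K n)) (x : PP K n) : Prop :=
  ∀ (v : Fin n → K) (h : v ≠ 0), Projectivization.mk K v h = x →
    Module.finrank K (gradSpan X v) = n - 2

/-- Smooth point of a *surface* `S ⊂ ℙ³` (Jacobian criterion). -/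
def SurfSmoothPt (S : Set (PP K 4)) (x : PP K 4) : Prop :=
  ∀ (v : Fin 4 → K) (h : v ≠ 0), Projectivization.mk K v h = x →
    Module.finrank K (gradSpan S v) = 1

/-- The singular locus of a surface `S ⊂ ℙ³`. -/
def singLocus (S : Set (PP K 4)) : Set (PP K 4) := {x ∈ S | ¬ SurfSmoothPt S x}


/-! ### Products of projective spaces -/

/-- Vanishing of a bihomogeneous polynomial at a point of `ℙ^(a-1) × ℙ^(b-1)`. -/
def vanishes2 {a b : ℕ} (p : MvPolynomial (Fin a ⊕ Fin b) K) (x : PP K a × PP K b) : Prop :=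
  ∀ (u : Fin a → K) (hu : u ≠ 0) (v : Fin b → K) (hv : v ≠ 0),
    Projectivization.mk K u hu = x.1 → Projectivization.mk K v hv = x.2 →
      eval (Sum.elim u v) p = 0

/-- Bihomogeneous polynomial (of some bidegree). -/
def IsBiHomog {a b : ℕ} (p : MvPolynomial (Fin a ⊕ Fin b) K) : Prop :=
  ∃ d e : ℕ, IsWeightedHomogeneous (Sum.elim (fun _ => (1:ℕ)) (fun _ => 0)) p d ∧
    IsWeightedHomogeneous (Sum.elim (fun _ => (0:ℕ)) (fun _ => 1)) p e

/-- Bihomogeneous polynomial of bidegree `(d,e)`. -/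
def IsBiHomogOf {a b : ℕ} (p : MvPolynomial (Fin a ⊕ Fin b) K) (d e : ℕ) : Prop :=
  IsWeightedHomogeneous (Sum.elim (fun _ => (1:ℕ)) (fun _ => 0)) p d ∧
    IsWeightedHomogeneous (Sum.elim (fun _ => (0:ℕ)) (fun _ => 1)) p e

def zeroLocus2 {a b : ℕ} (S : Set (MvPolynomial (Fin a ⊕ Fin b) K)) :
    Set (PP K a × PP K b) :=
  {x | ∀ p ∈ S, vanishes2 p x}

def ZClosed2 {a b : ℕ} (X : Set (PP K a × PP K b)) : Prop :=
  ∃ S : Set (MvPolynomial (Fin a ⊕ Fin b) K), (∀ p ∈ S, IsBiHomog p) ∧ X = zeroLocus2 S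

def ZIrred2 {a b : ℕ} (X : Set (PP K a × PP K b)) : Prop :=
  X.Nonempty ∧ ∀ A B : Set (PP K a × PP K b), ZClosed2 A → ZClosed2 B → X ⊆ A ∪ B →
    X ⊆ A ∨ X ⊆ B

def dimGE2 {a b : ℕ} (X : Set (PP K a × PP K b)) (d : ℕ) : Prop :=
  ∃ f : Fin (d + 1) → Set (PP K a × PP K b),
    (∀ i, ZClosed2 (f i) ∧ ZIrred2 (f i) ∧ f i ⊆ X) ∧ StrictMono f

def HasDim2 {a b : ℕ} (X : Set (PP K a × PP K b)) (d : ℕ) : Prop :=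
  dimGE2 X d ∧ ¬ dimGE2 X (d + 1)


/-- The automorphism of projective space induced by a linear automorphism
(a projective coordinate change). -/
def projMap {n : ℕ} (A : (Fin n → K) ≃ₗ[K] (Fin n → K)) : PP K n → PP K n :=
  Projectivization.map A.toLinearMap A.injective

/-- Two subsets of projective space are projectively equivalent. -/
def ProjEquiv {n : ℕ} (S T : Set (PP K n)) : Prop :=
  ∃ A : (Fin n → K) ≃ₗ[K] (Fin n → K), projMap A '' S = T

/-- The value at `u` of the binary quadratic form with coefficients `q`. -/
def quadEval (q : Fin 3 → K) (u : Fin 2 → K) : K :=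
  q 0 * u 0 ^ 2 + q 1 * (u 0 * u 1) + q 2 * u 1 ^ 2

/-- The binary quadratic form `q ∘ g`. -/
def quadSub (q : Fin 3 → K) (g : Matrix (Fin 2) (Fin 2) K) : Fin 3 → K :=
  ![q 0 * g 0 0 ^ 2 + q 1 * (g 0 0 * g 1 0) + q 2 * g 1 0 ^ 2,
    2 * q 0 * (g 0 0 * g 0 1) + q 1 * (g 0 0 * g 1 1 + g 0 1 * g 1 0) + 2 * q 2 * (g 1 0 * g 1 1),
    q 0 * g 0 1 ^ 2 + q 1 * (g 0 1 * g 1 1) + q 2 * g 1 1 ^ 2]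

/-- The polarization of the discriminant of binary quadratic forms. -/
def apolar (p q : Fin 3 → K) : K := p 1 * q 1 - 2 * (p 0 * q 2 + p 2 * q 0)

theorem quadEval_quadSub (q : Fin 3 → K) (g : Matrix (Fin 2) (Fin 2) K) (u : Fin 2 → K) :
    quadEval (quadSub q g) u = quadEval q (g.mulVec u) := by
  simp [quadEval, quadSub, Matrix.mulVec, dotProduct, Fin.sum_univ_two]
  ring

theorem quadSub_mul (q : Fin 3 → K) (g h : Matrix (Fin 2) (Fin 2) K) :
    quadSub q (g * h) = quadSub (quadSub q g) h := by
  ext i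
  fin_cases i <;> simp [quadSub, Matrix.mul_apply, Fin.sum_univ_two] <;> ring

theorem apolar_quadSub (p q : Fin 3 → K) (g : Matrix (Fin 2) (Fin 2) K) :
    apolar (quadSub p g) (quadSub q g) = g.det ^ 2 * apolar p q := by
  simp [apolar, quadSub, Matrix.det_fin_two]
  ring

/-- The value at `u` of the binary quartic form with coefficients `d`. -/
def quarticEval (d : Fin 5 → K) (u : Fin 2 → K) : K :=
  d 0 * u 0 ^ 4 + d 1 * (u 0 ^ 3 * u 1) + d 2 * (u 0 ^ 2 * u 1 ^ 2) + d 3 * (u 0 * u 1 ^ 3)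
    + d 4 * u 1 ^ 4

/-- The gradient at `u` of the binary quartic form with coefficients `d`. -/
def quarticGrad (d : Fin 5 → K) (u : Fin 2 → K) : Fin 2 → K :=
  ![4 * d 0 * u 0 ^ 3 + 3 * d 1 * (u 0 ^ 2 * u 1) + 2 * d 2 * (u 0 * u 1 ^ 2) + d 3 * u 1 ^ 3,
    d 1 * u 0 ^ 3 + 2 * d 2 * (u 0 ^ 2 * u 1) + 3 * d 3 * (u 0 * u 1 ^ 2) + 4 * d 4 * u 1 ^ 3]

/-- All zeros of the binary quartic form with coefficients `d` are simple. -/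
def SimpleZeros (d : Fin 5 → K) : Prop :=
  ∀ u : Fin 2 → K, u ≠ 0 → quarticEval d u = 0 → quarticGrad d u ≠ 0

/-- The binary quartic form `d ∘ g`. -/
def quarticSub (d : Fin 5 → K) (g : Matrix (Fin 2) (Fin 2) K) : Fin 5 → K :=
  let a := g 0 0
  let b := g 0 1
  let c := g 1 0
  let e := g 1 1
  ![quarticEval d ![a, c],
    d 0 * (4 * a ^ 3 * b) + d 1 * (a ^ 3 * e + 3 * a ^ 2 * b * c)
      + d 2 * (2 * a ^ 2 * c * e + 2 * a * b * c ^ 2)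
      + d 3 * (b * c ^ 3 + 3 * a * c ^ 2 * e) + d 4 * (4 * c ^ 3 * e),
    d 0 * (6 * a ^ 2 * b ^ 2) + d 1 * (3 * a ^ 2 * b * e + 3 * a * b ^ 2 * c)
      + d 2 * (a ^ 2 * e ^ 2 + 4 * a * b * c * e + b ^ 2 * c ^ 2)
      + d 3 * (3 * a * c * e ^ 2 + 3 * b * c ^ 2 * e) + d 4 * (6 * c ^ 2 * e ^ 2),
    d 0 * (4 * a * b ^ 3) + d 1 * (b ^ 3 * c + 3 * a * b ^ 2 * e)
      + d 2 * (2 * b ^ 2 * c * e + 2 * a * b * e ^ 2)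
      + d 3 * (a * e ^ 3 + 3 * b * c * e ^ 2) + d 4 * (4 * c * e ^ 3),
    quarticEval d ![b, e]]

theorem quarticEval_quarticSub (d : Fin 5 → K) (g : Matrix (Fin 2) (Fin 2) K) (u : Fin 2 → K) :
    quarticEval (quarticSub d g) u = quarticEval d (g.mulVec u) := by
  simp [quarticEval, quarticSub, Matrix.mulVec, dotProduct, Fin.sum_univ_two]
  ring

theorem quarticSub_mul (d : Fin 5 → K) (g h : Matrix (Fin 2) (Fin 2) K) :
    quarticSub d (g * h) = quarticSub (quarticSub d g) h := by
  ext i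
  fin_cases i <;> simp [quarticSub, quarticEval, Matrix.mul_apply, Fin.sum_univ_two] <;> ring

theorem quarticGrad_quarticSub (d : Fin 5 → K) (g : Matrix (Fin 2) (Fin 2) K) (u : Fin 2 → K) :
    quarticGrad (quarticSub d g) u = g.transpose.mulVec (quarticGrad d (g.mulVec u)) := by
  ext i
  fin_cases i <;>
    simp [quarticGrad, quarticSub, quarticEval, Matrix.mulVec, dotProduct, Fin.sum_univ_two] <;>
    ring

theorem SimpleZeros.comp {d : Fin 5 → K} (hd : SimpleZeros d)
    {g : Matrix (Fin 2) (Fin 2) K} (hg : g.det ≠ 0) : SimpleZeros (quarticSub d g) := by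
  intro u hu h0 h1
  rw [quarticEval_quarticSub] at h0
  rw [quarticGrad_quarticSub] at h1
  refine hd _ (fun h => hu (Matrix.eq_zero_of_mulVec_eq_zero hg h)) h0 ?_
  exact Matrix.eq_zero_of_mulVec_eq_zero (by rwa [Matrix.det_transpose]) h1

theorem exists_quadEval_eq_zero [IsAlgClosed K] (q : Fin 3 → K) :
    ∃ u : Fin 2 → K, u ≠ 0 ∧ quadEval q u = 0 := by
  by_cases h : q 0 = 0
  · exact ⟨![1, 0], by simp, by simp [quadEval, h]⟩
  · have hdeg : (Polynomial.C (q 0) * Polynomial.X ^ 2 + Polynomial.C (q 1) * Polynomial.X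
        + Polynomial.C (q 2)).degree ≠ 0 := by
      rw [Polynomial.degree_quadratic h]; decide
    obtain ⟨z, hz⟩ := IsAlgClosed.exists_root _ hdeg
    refine ⟨![z, 1], by simp, ?_⟩
    simpa [quadEval, Polynomial.IsRoot] using hz

theorem exists_quarticEval_eq_zero [IsAlgClosed K] (d : Fin 5 → K) :
    ∃ u : Fin 2 → K, u ≠ 0 ∧ quarticEval d u = 0 := by
  by_cases h : d 0 = 0
  · exact ⟨![1, 0], by simp, by simp [quarticEval, h]⟩
  · have hdeg : (Polynomial.C (d 0) * Polynomial.X ^ 4 + (Polynomial.C (d 1) * Polynomial.X ^ 3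
        + Polynomial.C (d 2) * Polynomial.X ^ 2 + Polynomial.C (d 3) * Polynomial.X
        + Polynomial.C (d 4))).degree ≠ 0 := by
      rw [Polynomial.degree_add_eq_left_of_degree_lt, Polynomial.degree_C_mul_X_pow 4 h]
      · decide
      · rw [Polynomial.degree_C_mul_X_pow 4 h]
        exact lt_of_le_of_lt Polynomial.degree_cubic_le (by decide)
    obtain ⟨z, hz⟩ := IsAlgClosed.exists_root _ hdeg
    refine ⟨![z, 1], by simp, ?_⟩
    simp [Polynomial.IsRoot] at hz
    simp [quarticEval]
    linear_combination hz

/-- Every nonzero vector of the plane is the first column of an invertible matrix. -/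
theorem exists_det_ne_zero_of_ne_zero (u : Fin 2 → K) (hu : u ≠ 0) :
    ∃ g : Matrix (Fin 2) (Fin 2) K, g.det ≠ 0 ∧ g 0 0 = u 0 ∧ g 1 0 = u 1 := by
  by_cases h : u 0 = 0
  · have h1 : u 1 ≠ 0 := fun h1 => hu (by ext i; fin_cases i <;> simp [h, h1])
    exact ⟨!![u 0, 1; u 1, 0], by simp [Matrix.det_fin_two, h1], by simp, by simp⟩
  · exact ⟨!![u 0, 0; u 1, 1], by simp [Matrix.det_fin_two, h], by simp, by simp⟩

/-- A binary quartic with simple zeros has the form `x y (a x² + b x y + c y²)` in suitable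
coordinates. -/
theorem SimpleZeros.exists_quarticSub_ends_eq_zero [IsAlgClosed K] {d : Fin 5 → K}
    (hd : SimpleZeros d) :
    ∃ g : Matrix (Fin 2) (Fin 2) K, g.det ≠ 0 ∧ quarticSub d g 0 = 0 ∧ quarticSub d g 4 = 0 := by
  obtain ⟨u, hu, hu0⟩ := exists_quarticEval_eq_zero d
  obtain ⟨g, hg, hg0, hg1⟩ := exists_det_ne_zero_of_ne_zero u hu
  have h0 : quarticSub d g 0 = 0 := by
    simpa [quarticSub, hg0, hg1, quarticEval] using hu0
  have hs := hd.comp hg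
  have h1 : quarticSub d g 1 ≠ 0 := by
    intro h1
    refine hs ![1, 0] (by simp) (by simp [quarticEval, h0]) ?_
    ext i
    fin_cases i <;> simp [quarticGrad, h0, h1]
  generalize hd' : quarticSub d g = d' at *
  obtain ⟨z, hz⟩ := IsAlgClosed.exists_root (Polynomial.C (d' 1) * Polynomial.X ^ 3
    + Polynomial.C (d' 2) * Polynomial.X ^ 2 + Polynomial.C (d' 3) * Polynomial.X
    + Polynomial.C (d' 4)) (by rw [Polynomial.degree_cubic h1]; decide)
  refine ⟨g * !![1, z; 0, 1], ?_, ?_, ?_⟩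
  · simpa [Matrix.det_mul, Matrix.det_fin_two] using hg
  · rw [quarticSub_mul, hd']
    simp [quarticSub, quarticEval, h0]
  · rw [quarticSub_mul, hd']
    simp [Polynomial.IsRoot] at hz
    simp [quarticSub, quarticEval, h0]
    linear_combination hz

/-- A binary quartic with simple zeros is diagonal in `x²`, `y²` in suitable coordinates. -/
theorem SimpleZeros.exists_quarticSub_even [IsAlgClosed K] (h2 : (2 : K) ≠ 0) {d : Fin 5 → K}
    (hd : SimpleZeros d) :
    ∃ g : Matrix (Fin 2) (Fin 2) K, g.det ≠ 0 ∧ ∃ p m n : K, p ≠ 0 ∧ n ≠ 0 ∧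
      quarticSub d g = ![p, 0, m, 0, n] := by
  obtain ⟨g, hg, h0, h4⟩ := hd.exists_quarticSub_ends_eq_zero
  have hs := hd.comp hg
  generalize hd' : quarticSub d g = d' at *
  have h1 : d' 1 ≠ 0 := by
    intro h1
    refine hs ![1, 0] (by simp) (by simp [quarticEval, h0]) ?_
    ext i
    fin_cases i <;> simp [quarticGrad, h0, h1]
  have h3 : d' 3 ≠ 0 := by
    intro h3
    refine hs ![0, 1] (by simp) (by simp [quarticEval, h4]) ?_
    ext i
    fin_cases i <;> simp [quarticGrad, h4, h3]
  have hdisc : d' 2 ^ 2 - 4 * d' 1 * d' 3 ≠ 0 := by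
    intro h
    refine hs ![-d' 2, 2 * d' 1] (by simp [h1, h2]) ?_ ?_
    · simp [quarticEval, h0, h4]
      linear_combination (2 * d' 1 ^ 2 * d' 2) * h
    · ext i
      fin_cases i
      · simp [quarticGrad, h0, h4]
        linear_combination (-2 * d' 1 ^ 2) * h
      · simp [quarticGrad, h0, h4]
        linear_combination (3 * d' 1 * d' 2) * h
  obtain ⟨s, hs2⟩ := IsAlgClosed.exists_pow_nat_eq (d' 3 / d' 1) (n := 2) (by norm_num)
  have hsd : d' 1 * s ^ 2 = d' 3 := by
    rw [hs2]
    field_simp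
  have hs0 : s ≠ 0 := by
    rintro rfl
    exact h3 (by simpa using hsd.symm)
  have hprod : d' 1 * ((2 * d' 3 + d' 2 * s) * (2 * d' 3 - d' 2 * s)) ≠ 0 := by
    have : d' 1 * ((2 * d' 3 + d' 2 * s) * (2 * d' 3 - d' 2 * s))
        = - d' 3 * (d' 2 ^ 2 - 4 * d' 1 * d' 3) := by
      linear_combination (-d' 2 ^ 2) * hsd
    rw [this]
    exact mul_ne_zero (neg_ne_zero.mpr h3) hdisc
  have hpn := right_ne_zero_of_mul hprod
  refine ⟨g * !![s, s; 1, -1], ?_, s * (2 * d' 3 + d' 2 * s), -2 * d' 2 * s ^ 2,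
    -(s * (2 * d' 3 - d' 2 * s)), mul_ne_zero hs0 (left_ne_zero_of_mul hpn),
    neg_ne_zero.mpr (mul_ne_zero hs0 (right_ne_zero_of_mul hpn)), ?_⟩
  · rw [Matrix.det_mul, Matrix.det_fin_two_of]
    refine mul_ne_zero hg ?_
    have : s * -1 - s * 1 = -(2 * s) := by ring
    rw [this]
    exact neg_ne_zero.mpr (mul_ne_zero h2 hs0)
  · rw [quarticSub_mul, hd']
    ext i
    fin_cases i
    · simp [quarticSub, quarticEval, h0, h4]
      linear_combination s * hsd
    · simp [quarticSub, h0, h4]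
      linear_combination (2 * s) * hsd
    · simp [quarticSub, h0, h4]
      ring
    · simp [quarticSub, h0, h4]
      linear_combination (-2 * s) * hsd
    · simp [quarticSub, quarticEval, h0, h4]
      linear_combination (-s) * hsd

/-- A binary quartic with simple zeros is `α (x⁴ + y⁴) + 2 β x² y²` with `α ≠ 0` and `α ≠ ± β` in
suitable coordinates. -/
theorem SimpleZeros.exists_quarticSub_eq [IsAlgClosed K] (h2 : (2 : K) ≠ 0) {d : Fin 5 → K}
    (hd : SimpleZeros d) :
    ∃ g : Matrix (Fin 2) (Fin 2) K, g.det ≠ 0 ∧ ∃ α β : K, α ≠ 0 ∧ α ≠ β ∧ α ≠ -β ∧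
      quarticSub d g = ![α, 0, 2 * β, 0, α] := by
  obtain ⟨g, hg, p, m, n, hp, hn, he⟩ := hd.exists_quarticSub_even h2
  obtain ⟨a, ha⟩ := IsAlgClosed.exists_pow_nat_eq (n / p) (n := 4) (by norm_num)
  have hap : p * a ^ 4 = n := by
    rw [ha]
    field_simp
  have ha0 : a ≠ 0 := by
    rintro rfl
    exact hn (by simpa using hap.symm)
  have hdet : (g * !![a, 0; 0, 1]).det ≠ 0 := by
    rw [Matrix.det_mul, Matrix.det_fin_two_of]
    simpa using ⟨hg, ha0⟩
  have heq : quarticSub d (g * !![a, 0; 0, 1]) = ![n, 0, 2 * (m * a ^ 2 / 2), 0, n] := by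
    rw [quarticSub_mul, he, mul_div_cancel₀ _ h2]
    ext i
    fin_cases i <;> simp [quarticSub, quarticEval, hap]
  have hs := hd.comp hdet
  rw [heq] at hs
  refine ⟨_, hdet, n, m * a ^ 2 / 2, hn, ?_, ?_, heq⟩
  · intro h
    rw [← h] at hs
    obtain ⟨i, hi⟩ := IsAlgClosed.exists_pow_nat_eq (-1 : K) (n := 2) (by norm_num)
    refine hs ![i, 1] (by simp) ?_ ?_
    · simp [quarticEval]
      linear_combination (n * (i ^ 2 + 1)) * hi
    · ext j
      fin_cases j
      · simp [quarticGrad]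
        linear_combination (4 * n * i) * hi
      · simp [quarticGrad]
        linear_combination (4 * n) * hi
  · intro h
    rw [← neg_eq_iff_eq_neg.mpr h] at hs
    refine hs ![1, 1] (by simp) ?_ ?_
    · simp [quarticEval]
      ring
    · ext j
      fin_cases j <;> simp [quarticGrad] <;> ring

/-- A nondegenerate binary quadratic form is a multiple of `x y` in suitable coordinates. -/
theorem exists_quadSub_eq_mul [IsAlgClosed K] {q : Fin 3 → K}
    (hq : apolar q q ≠ 0) :
    ∃ g : Matrix (Fin 2) (Fin 2) K, g.det ≠ 0 ∧ ∃ c : K, c ≠ 0 ∧ quadSub q g = ![0, c, 0] := by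
  obtain ⟨u, hu, hu0⟩ := exists_quadEval_eq_zero q
  obtain ⟨g, hg, hg0, hg1⟩ := exists_det_ne_zero_of_ne_zero u hu
  have h0 : quadSub q g 0 = 0 := by
    simpa [quadSub, quadEval, hg0, hg1] using hu0
  have hd : apolar (quadSub q g) (quadSub q g) ≠ 0 := by
    rw [apolar_quadSub]
    exact mul_ne_zero (pow_ne_zero 2 hg) hq
  generalize hq' : quadSub q g = q' at *
  have h1 : q' 1 ≠ 0 := by
    intro h1
    exact hd (by simp [apolar, h0, h1])
  refine ⟨g * !![1, -(q' 2 / q' 1); 0, 1], ?_, q' 1, h1, ?_⟩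
  · simpa [Matrix.det_mul, Matrix.det_fin_two_of] using hg
  · rw [quadSub_mul, hq']
    ext i
    fin_cases i <;> simp [quadSub, h0]
    field_simp
    ring

/-- Three pairwise apolar binary quadratic forms, the third and one of the others nondegenerate,
are multiples of `x² + y²`, `x² - y²`, `x y` in suitable coordinates. -/
theorem exists_quadSub_eq_of_apolar_third [IsAlgClosed K] (h2 : (2 : K) ≠ 0) {p q r : Fin 3 → K}
    (hpq : apolar p q = 0) (hpr : apolar p r = 0) (hqr : apolar q r = 0)
    (hr : apolar r r ≠ 0) (hne : apolar p p ≠ 0 ∨ apolar q q ≠ 0) :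
    ∃ g : Matrix (Fin 2) (Fin 2) K, g.det ≠ 0 ∧ ∃ a b c : K,
      quadSub p g = ![a, 0, a] ∧ quadSub q g = ![b, 0, -b] ∧ quadSub r g = ![0, c, 0] := by
  obtain ⟨g, hg, c, hc, hrg⟩ := exists_quadSub_eq_mul hr
  have key := fun s t : Fin 3 → K => apolar_quadSub s t g
  have hpq' := key p q
  have hpr' := key p r
  have hqr' := key q r
  have hpp' := key p p
  have hqq' := key q q
  rw [hpq, mul_zero] at hpq'
  rw [hpr, mul_zero, hrg] at hpr'
  rw [hqr, mul_zero, hrg] at hqr'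
  have hg2 := pow_ne_zero 2 hg
  generalize hp : quadSub p g = p' at *
  generalize hq : quadSub q g = q' at *
  have hp1 : p' 1 = 0 := by simpa [apolar, hc] using hpr'
  have hq1 : q' 1 = 0 := by simpa [apolar, hc] using hqr'
  have hortho : p' 0 * q' 2 + p' 2 * q' 0 = 0 := by simpa [apolar, hp1, h2] using hpq'
  obtain ⟨t, ht, htp, htq⟩ : ∃ t : K, t ≠ 0 ∧ p' 0 * t ^ 2 = p' 2 ∧ q' 0 * t ^ 2 = -q' 2 := by
    rcases hne with h | h
    · have hne : apolar p' p' ≠ 0 := hpp' ▸ mul_ne_zero hg2 h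
      have h0 : p' 0 ≠ 0 := fun h0 => hne (by simp [apolar, hp1, h0])
      have h2' : p' 2 ≠ 0 := fun h0 => hne (by simp [apolar, hp1, h0])
      obtain ⟨t, ht⟩ := IsAlgClosed.exists_pow_nat_eq (p' 2 / p' 0) (n := 2) (by norm_num)
      have htp : p' 0 * t ^ 2 = p' 2 := by
        rw [ht]
        field_simp
      refine ⟨t, ?_, htp, mul_left_cancel₀ h0 ?_⟩
      · rintro rfl
        exact h2' (by simpa using htp.symm)
      · linear_combination q' 0 * htp + hortho
    · have hne : apolar q' q' ≠ 0 := hqq' ▸ mul_ne_zero hg2 h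
      have h0 : q' 0 ≠ 0 := fun h0 => hne (by simp [apolar, hq1, h0])
      have h2' : q' 2 ≠ 0 := fun h0 => hne (by simp [apolar, hq1, h0])
      obtain ⟨t, ht⟩ := IsAlgClosed.exists_pow_nat_eq (-q' 2 / q' 0) (n := 2) (by norm_num)
      have htq : q' 0 * t ^ 2 = -q' 2 := by
        rw [ht]
        field_simp
      refine ⟨t, ?_, mul_left_cancel₀ h0 ?_, htq⟩
      · rintro rfl
        exact h2' (by simpa using htq.symm)
      · linear_combination p' 0 * htq - hortho
  refine ⟨g * !![t, 0; 0, 1], ?_, p' 2, -q' 2, c * t, ?_, ?_, ?_⟩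
  · simpa [Matrix.det_mul, Matrix.det_fin_two_of] using ⟨hg, ht⟩
  · rw [quadSub_mul, hp]
    ext i
    fin_cases i <;> simp [quadSub, hp1, htp]
  · rw [quadSub_mul, hq]
    ext i
    fin_cases i <;> simp [quadSub, hq1, htq]
  · rw [quadSub_mul, hrg]
    ext i
    fin_cases i <;> simp [quadSub]

/-- Three pairwise apolar binary quadratic forms, at most one of them degenerate, are multiples of
`x² + y²`, `x² - y²`, `x y` in suitable coordinates. -/
theorem exists_quadSub_eq_of_apolar [IsAlgClosed K] (h2 : (2 : K) ≠ 0) {p q r : Fin 3 → K}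
    (hpq : apolar p q = 0) (hpr : apolar p r = 0) (hqr : apolar q r = 0)
    (hne₁ : apolar p p ≠ 0 ∨ apolar q q ≠ 0) (hne₂ : apolar p p ≠ 0 ∨ apolar r r ≠ 0)
    (hne₃ : apolar q q ≠ 0 ∨ apolar r r ≠ 0) :
    ∃ g : Matrix (Fin 2) (Fin 2) K, g.det ≠ 0 ∧ ∃ a b c : K,
      quadSub p g = ![a, 0, a] ∧ quadSub q g = ![b, 0, -b] ∧ quadSub r g = ![0, c, 0] := by
  by_cases hr : apolar r r = 0
  · have hp := hne₂.resolve_right (not_not.mpr hr)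
    have hq := hne₃.resolve_right (not_not.mpr hr)
    -- The Jacobian of `p` and `q` is apolar to both and nondegenerate.
    obtain ⟨j, hj⟩ : ∃ j : Fin 3 → K, j = ![p 0 * q 1 - p 1 * q 0, 2 * (p 0 * q 2 - p 2 * q 0),
      p 1 * q 2 - p 2 * q 1] := ⟨_, rfl⟩
    have hpj : apolar p j = 0 := by
      simp [apolar, hj]
      ring
    have hqj : apolar q j = 0 := by
      simp [apolar, hj]
      ring
    have hjj : apolar j j ≠ 0 := by
      have : apolar j j = apolar p q ^ 2 - apolar p p * apolar q q := by
        simp [apolar, hj]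
        ring
      rw [this, hpq]
      simpa using ⟨hp, hq⟩
    obtain ⟨g, hg, a, b, c, hpg, hqg, -⟩ :=
      exists_quadSub_eq_of_apolar_third h2 hpq hpj hqj hjj hne₁
    have hg2 := pow_ne_zero 2 hg
    have key := fun s t : Fin 3 → K => apolar_quadSub s t g
    have hpp' := key p p ▸ mul_ne_zero hg2 hp
    have hqq' := key q q ▸ mul_ne_zero hg2 hq
    have hpr' := key p r
    have hqr' := key q r
    rw [hpr, mul_zero] at hpr'
    rw [hqr, mul_zero] at hqr'
    rw [hpg] at hpr' hpp'
    rw [hqg] at hqr' hqq'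
    have ha : a ≠ 0 := by
      rintro rfl
      simp [apolar] at hpp'
    have hb : b ≠ 0 := by
      rintro rfl
      simp [apolar] at hqq'
    have hsum : quadSub r g 2 + quadSub r g 0 = 0 := by
      refine mul_left_cancel₀ (mul_ne_zero h2 ha) ?_
      simp [apolar, h2] at hpr'
      linear_combination 2 * hpr'
    have hdiff : quadSub r g 2 - quadSub r g 0 = 0 := by
      refine mul_left_cancel₀ (mul_ne_zero h2 hb) ?_
      simp [apolar, h2] at hqr'
      linear_combination 2 * hqr'
    have hr2 : quadSub r g 2 = 0 := by
      refine mul_left_cancel₀ h2 ?_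
      linear_combination hsum + hdiff
    have hr0 : quadSub r g 0 = 0 := by linear_combination hsum - hr2
    refine ⟨g, hg, a, b, quadSub r g 1, hpg, hqg, ?_⟩
    ext i
    fin_cases i <;> simp [hr0, hr2]
  · exact exists_quadSub_eq_of_apolar_third h2 hpq hpr hqr hr hne₁

/-- The gradient at `u` of the binary quadratic form with coefficients `q`. -/
def quadGrad (q : Fin 3 → K) (u : Fin 2 → K) : Fin 2 → K :=
  ![2 * q 0 * u 0 + q 1 * u 1, q 1 * u 0 + 2 * q 2 * u 1]

/-- The value at `(u, v)` of the form of bidegree `(2, 2)` with coefficients `r`. -/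
def formEval (r : Fin 3 → Fin 3 → K) (u v : Fin 2 → K) : K :=
  quadEval (fun i => quadEval (r i) v) u

/-- The `(2, 2)`-form `(u, v) ↦ r (g u, v)`. -/
def formSub (r : Fin 3 → Fin 3 → K) (g : Matrix (Fin 2) (Fin 2) K) : Fin 3 → Fin 3 → K :=
  fun i j => quadSub (fun k => r k j) g i

/-- The quadratic form `v ↦ r (u, v)`. -/
def fiberForm (r : Fin 3 → Fin 3 → K) (u : Fin 2 → K) : Fin 3 → K :=
  fun j => quadEval (fun i => r i j) u

/-- The discriminant of `v ↦ r (u, v)`, a binary quartic form in `u`. -/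
def formDisc (r : Fin 3 → Fin 3 → K) : Fin 5 → K :=
  ![apolar (r 0) (r 0), 2 * apolar (r 0) (r 1), apolar (r 1) (r 1) + 2 * apolar (r 0) (r 2),
    2 * apolar (r 1) (r 2), apolar (r 2) (r 2)]

theorem formEval_formSub (r : Fin 3 → Fin 3 → K) (g : Matrix (Fin 2) (Fin 2) K)
    (u v : Fin 2 → K) : formEval (formSub r g) u v = formEval r (g.mulVec u) v := by
  simp only [formEval, ← quadEval_quadSub]
  simp [quadEval, formSub, quadSub]
  ring

theorem formDisc_formSub (r : Fin 3 → Fin 3 → K) (g : Matrix (Fin 2) (Fin 2) K) :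
    formDisc (formSub r g) = quarticSub (formDisc r) g := by
  ext i
  fin_cases i <;> simp [formDisc, formSub, quadSub, quarticSub, quarticEval, apolar] <;> ring

theorem quarticEval_formDisc (r : Fin 3 → Fin 3 → K) (u : Fin 2 → K) :
    quarticEval (formDisc r) u = apolar (fiberForm r u) (fiberForm r u) := by
  simp [quarticEval, formDisc, fiberForm, quadEval, apolar]
  ring

theorem quarticGrad_formDisc (r : Fin 3 → Fin 3 → K) (u : Fin 2 → K) (k : Fin 2) :
    quarticGrad (formDisc r) u k
      = 2 * apolar (fiberForm r u) (fun j => quadGrad (fun i => r i j) u k) := by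
  fin_cases k <;>
    simp [quarticGrad, formDisc, fiberForm, quadEval, quadGrad, apolar] <;> ring

theorem formEval_eq_quadEval_fiberForm (r : Fin 3 → Fin 3 → K) (u v : Fin 2 → K) :
    formEval r u v = quadEval (fiberForm r u) v := by
  simp [formEval, fiberForm, quadEval]
  ring

theorem quadGrad_quadEval (r : Fin 3 → Fin 3 → K) (u v : Fin 2 → K) (k : Fin 2) :
    quadGrad (fun i => quadEval (r i) v) u k
      = quadEval (fun j => quadGrad (fun i => r i j) u k) v := by
  fin_cases k <;> simp [quadGrad, quadEval] <;> ring

theorem quadGrad_euler (q : Fin 3 → K) (u : Fin 2 → K) :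
    u 0 * quadGrad q u 0 + u 1 * quadGrad q u 1 = 2 * quadEval q u := by
  simp [quadGrad, quadEval]
  ring

/-- The curve `r = 0` in `ℙ¹ × ℙ¹` is nonsingular. -/
def FormSmooth (r : Fin 3 → Fin 3 → K) : Prop :=
  ∀ u v : Fin 2 → K, u ≠ 0 → v ≠ 0 → formEval r u v = 0 →
    quadGrad (fun i => quadEval (r i) v) u = 0 → quadGrad (fiberForm r u) v ≠ 0

theorem FormSmooth.fiberForm_ne_zero [IsAlgClosed K] {r : Fin 3 → Fin 3 → K} (hr : FormSmooth r)
    {u : Fin 2 → K} (hu : u ≠ 0) : fiberForm r u ≠ 0 := by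
  intro h
  have hF : ∀ v, formEval r u v = 0 := fun v => by
    simp [formEval_eq_quadEval_fiberForm, h, quadEval]
  have hE := fun v => quadGrad_euler (fun i => quadEval (r i) v) u
  have hgrad : ∀ v, quadGrad (fiberForm r u) v = 0 := fun v => by
    ext i
    fin_cases i <;> simp [h, quadGrad]
  have hE' : ∀ v, u 0 * quadGrad (fun i => quadEval (r i) v) u 0
      + u 1 * quadGrad (fun i => quadEval (r i) v) u 1 = 0 := fun v => by
    rw [hE v]
    have := hF v
    rw [formEval] at this
    rw [this, mul_zero]
  have hcase : ∀ k : Fin 2, ∃ v : Fin 2 → K, v ≠ 0 ∧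
      quadGrad (fun i => quadEval (r i) v) u k = 0 := fun k => by
    simp only [quadGrad_quadEval]
    exact exists_quadEval_eq_zero _
  by_cases h0 : u 0 = 0
  · have h1 : u 1 ≠ 0 := fun h1 => hu (by ext i; fin_cases i <;> simp [h0, h1])
    obtain ⟨v, hv, hv0⟩ := hcase 0
    have h1' := hE' v
    rw [hv0, mul_zero, zero_add] at h1'
    refine hr u v hu hv (hF v) ?_ (hgrad v)
    ext i
    fin_cases i
    · exact hv0
    · exact (mul_eq_zero.mp h1').resolve_left h1
  · obtain ⟨v, hv, hv1⟩ := hcase 1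
    have h1' := hE' v
    rw [hv1, mul_zero, add_zero] at h1'
    refine hr u v hu hv (hF v) ?_ (hgrad v)
    ext i
    fin_cases i
    · exact (mul_eq_zero.mp h1').resolve_left h0
    · exact hv1

/-- A degenerate nonzero binary quadratic form has a double zero `v`, and evaluation of quadratic
forms at `v` is proportional to pairing with the form. -/
theorem exists_double_zero (h2 : (2 : K) ≠ 0) {q : Fin 3 → K} (hq : q ≠ 0)
    (hdisc : apolar q q = 0) :
    ∃ v : Fin 2 → K, v ≠ 0 ∧ quadEval q v = 0 ∧ quadGrad q v = 0 ∧
      ∀ p : Fin 3 → K, apolar q p = 0 → quadEval p v = 0 := by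
  have hd : q 1 ^ 2 = 4 * q 0 * q 2 := by
    simp only [apolar] at hdisc
    linear_combination hdisc
  by_cases h0 : q 0 = 0
  · have h1 : q 1 = 0 := by simpa [h0] using hd
    have hq2 : q 2 ≠ 0 := fun h => hq (by ext i; fin_cases i <;> simp [h0, h1, h])
    refine ⟨![1, 0], by simp, by simp [quadEval, h0], ?_, fun p hp => ?_⟩
    · ext i
      fin_cases i <;> simp [quadGrad, h0, h1]
    · simp [apolar, h0, h1, h2, hq2] at hp
      simp [quadEval, hp]
  · refine ⟨![-q 1, 2 * q 0], by simp [h0, h2], ?_, ?_, fun p hp => ?_⟩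
    · simp [quadEval]
      linear_combination (-q 0) * hd
    · ext i
      fin_cases i
      · simp [quadGrad]
        ring
      · simp [quadGrad]
        linear_combination -hd
    · simp only [apolar] at hp
      simp [quadEval]
      linear_combination p 0 * hd - 2 * q 0 * hp

theorem FormSmooth.simpleZeros_formDisc [IsAlgClosed K] (h2 : (2 : K) ≠ 0)
    {r : Fin 3 → Fin 3 → K} (hr : FormSmooth r) : SimpleZeros (formDisc r) := by
  intro u hu h0 hgrad
  rw [quarticEval_formDisc] at h0
  obtain ⟨v, hv, hv0, hv1, hv2⟩ := exists_double_zero h2 (hr.fiberForm_ne_zero hu) h0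
  refine hr u v hu hv (by rw [formEval_eq_quadEval_fiberForm, hv0]) ?_ hv1
  ext k
  rw [quadGrad_quadEval]
  apply hv2
  have := congrFun hgrad k
  rw [quarticGrad_formDisc] at this
  exact (mul_eq_zero.mp this).resolve_left h2

/-- A smooth `(2, 2)`-form is symmetric in suitable coordinates on the two factors. -/
theorem FormSmooth.exists_symmetric [IsAlgClosed K] (h2 : (2 : K) ≠ 0)
    {r : Fin 3 → Fin 3 → K} (hr : FormSmooth r) :
    ∃ g h : Matrix (Fin 2) (Fin 2) K, g.det ≠ 0 ∧ h.det ≠ 0 ∧ ∀ x y : Fin 2 → K,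
      formEval r (g.mulVec x) (h.mulVec y) = formEval r (g.mulVec y) (h.mulVec x) := by
  obtain ⟨g, hg, α, β, hα, hαβ, hαβ', heq⟩ := (hr.simpleZeros_formDisc h2).exists_quarticSub_eq h2
  rw [← formDisc_formSub] at heq
  generalize hs : formSub r g = s at heq
  have e0 : apolar (s 0) (s 0) = α := by simpa [formDisc] using congrFun heq 0
  have e1 : apolar (s 0) (s 1) = 0 := by simpa [formDisc, h2] using congrFun heq 1
  have e2 : apolar (s 1) (s 1) + 2 * apolar (s 0) (s 2) = 2 * β := by
    simpa [formDisc] using congrFun heq 2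
  have e3 : apolar (s 1) (s 2) = 0 := by simpa [formDisc, h2] using congrFun heq 3
  have e4 : apolar (s 2) (s 2) = α := by simpa [formDisc] using congrFun heq 4
  have hadd : apolar (s 0 + s 2) (s 0 + s 2) = 2 * α + 2 * apolar (s 0) (s 2) := by
    simp only [apolar, Pi.add_apply] at e0 e4 ⊢
    linear_combination e0 + e4
  have hsub : apolar (s 0 - s 2) (s 0 - s 2) = 2 * α - 2 * apolar (s 0) (s 2) := by
    simp only [apolar, Pi.sub_apply] at e0 e4 ⊢
    linear_combination e0 + e4
  obtain ⟨h, hh, a, b, c, hp, hq, hc⟩ := exists_quadSub_eq_of_apolar h2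
    (p := s 0 + s 2) (q := s 0 - s 2) (r := s 1)
    (by simp only [apolar, Pi.add_apply, Pi.sub_apply] at e0 e4 ⊢; linear_combination e0 - e4)
    (by simp only [apolar, Pi.add_apply] at e1 e3 ⊢; linear_combination e1 + e3)
    (by simp only [apolar, Pi.sub_apply] at e1 e3 ⊢; linear_combination e1 - e3)
    (by
      rw [hadd, hsub, ← not_and_or]
      rintro ⟨h1, h3⟩
      refine mul_ne_zero (mul_ne_zero h2 h2) hα ?_
      linear_combination h1 + h3)
    (by
      rw [hadd, ← not_and_or]
      rintro ⟨h1, h3⟩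
      refine hαβ' (mul_left_cancel₀ h2 ?_)
      linear_combination h1 + h3 - e2)
    (by
      rw [hsub, ← not_and_or]
      rintro ⟨h1, h3⟩
      refine hαβ (mul_left_cancel₀ h2 ?_)
      linear_combination h1 - h3 + e2)
  refine ⟨g, h, hg, hh, fun x y => mul_left_cancel₀ h2 ?_⟩
  rw [← formEval_formSub, ← formEval_formSub, hs]
  have expand : ∀ x y : Fin 2 → K, 2 * formEval s x (h.mulVec y)
      = (x 0 ^ 2 + x 1 ^ 2) * quadEval (quadSub (s 0 + s 2) h) y
        + (x 0 ^ 2 - x 1 ^ 2) * quadEval (quadSub (s 0 - s 2) h) y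
        + 2 * (x 0 * x 1) * quadEval (quadSub (s 1) h) y := fun x y => by
    simp only [quadEval_quadSub]
    simp only [formEval, quadEval, Pi.add_apply, Pi.sub_apply]
    ring
  rw [expand, expand, hp, hq, hc]
  simp [quadEval]
  ring

/-- The exponent of the monomial `u₀²⁻ⁱ u₁ⁱ v₀²⁻ʲ v₁ʲ`. -/
noncomputable def biExponent (i j : Fin 3) : Fin 2 ⊕ Fin 2 →₀ ℕ :=
  Finsupp.equivFunOnFinite.symm (Sum.elim ![2 - i, i] ![2 - j, j])

theorem IsBiHomogOf.eq_sum {F : MvPolynomial (Fin 2 ⊕ Fin 2) K} (hF : IsBiHomogOf F 2 2) :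
    F = ∑ i, ∑ j, monomial (biExponent i j) (coeff (biExponent i j) F) := by
  have hinj : Function.Injective (fun x : Fin 3 × Fin 3 => biExponent x.1 x.2) := by
    intro x y hxy
    have h1 := DFunLike.congr_fun hxy (Sum.inl 1)
    have h2 := DFunLike.congr_fun hxy (Sum.inr 1)
    simp [biExponent] at h1 h2
    exact Prod.ext (Fin.ext h1) (Fin.ext h2)
  have hsupp : F.support ⊆ Finset.univ.image (fun x : Fin 3 × Fin 3 => biExponent x.1 x.2) := by
    intro d hd
    have h1 := hF.1 (mem_support_iff.mp hd)
    have h2 := hF.2 (mem_support_iff.mp hd)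
    simp [Finsupp.weight_apply, Finsupp.sum_fintype] at h1 h2
    simp only [Finset.mem_image, Finset.mem_univ, true_and, Prod.exists]
    refine ⟨⟨d (Sum.inl 1), by omega⟩, ⟨d (Sum.inr 1), by omega⟩, ?_⟩
    ext k
    rcases k with k | k <;> fin_cases k <;> simp [biExponent] <;> omega
  conv_lhs => rw [F.as_sum]
  rw [Finset.sum_subset hsupp (fun d _ hd => by simp [notMem_support_iff.mp hd]),
    Finset.sum_image hinj.injOn, Fintype.sum_prod_type]

/-- The coefficients of a form of bidegree `(2, 2)`. -/
noncomputable def biCoeff (F : MvPolynomial (Fin 2 ⊕ Fin 2) K) (i j : Fin 3) : K :=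
  coeff (biExponent i j) F

theorem monomial_biExponent (i j : Fin 3) (c : K) :
    monomial (biExponent i j) c = C c * (X (Sum.inl 0) ^ (2 - i : ℕ) * X (Sum.inl 1) ^ (i : ℕ)
      * (X (Sum.inr 0) ^ (2 - j : ℕ) * X (Sum.inr 1) ^ (j : ℕ))) := by
  rw [monomial_eq, Finsupp.prod_fintype _ _ (by simp)]
  simp [biExponent]

theorem IsBiHomogOf.eq_sum_C_mul_X_pow {F : MvPolynomial (Fin 2 ⊕ Fin 2) K} (hF : IsBiHomogOf F 2 2) :
    F = ∑ i, ∑ j, C (biCoeff F i j) * (X (Sum.inl 0) ^ (2 - i : ℕ) * X (Sum.inl 1) ^ (i : ℕ)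
      * (X (Sum.inr 0) ^ (2 - j : ℕ) * X (Sum.inr 1) ^ (j : ℕ))) := by
  conv_lhs => rw [hF.eq_sum]
  simp only [monomial_biExponent, biCoeff]

theorem IsBiHomogOf.eval_eq {F : MvPolynomial (Fin 2 ⊕ Fin 2) K} (hF : IsBiHomogOf F 2 2)
    (u v : Fin 2 → K) : eval (Sum.elim u v) F = formEval (biCoeff F) u v := by
  conv_lhs => rw [hF.eq_sum_C_mul_X_pow]
  simp [Fin.sum_univ_three, formEval, quadEval]
  ring

theorem IsBiHomogOf.eval_pderiv_inl {F : MvPolynomial (Fin 2 ⊕ Fin 2) K} (hF : IsBiHomogOf F 2 2)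
    (u v : Fin 2 → K) (k : Fin 2) : eval (Sum.elim u v) (pderiv (Sum.inl k) F)
      = quadGrad (fun i => quadEval (biCoeff F i) v) u k := by
  conv_lhs => rw [hF.eq_sum_C_mul_X_pow]
  fin_cases k <;>
  · simp [Fin.sum_univ_three, quadGrad, quadEval, pderiv_X, Derivation.leibniz_pow]
    ring

theorem IsBiHomogOf.eval_pderiv_inr {F : MvPolynomial (Fin 2 ⊕ Fin 2) K} (hF : IsBiHomogOf F 2 2)
    (u v : Fin 2 → K) (k : Fin 2) : eval (Sum.elim u v) (pderiv (Sum.inr k) F)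
      = quadGrad (fiberForm (biCoeff F) u) v k := by
  conv_lhs => rw [hF.eq_sum_C_mul_X_pow]
  fin_cases k <;>
  · simp [Fin.sum_univ_three, quadGrad, quadEval, fiberForm, pderiv_X, Derivation.leibniz_pow]
    ring

/-- If an invertible linear map exchanges the two factors of the curve `F = 0`, applying it to the
first factor makes the curve symmetric. -/
theorem swap_mem_image_of_symmetric (F : MvPolynomial (Fin 2 ⊕ Fin 2) K)
    (A : (Fin 2 → K) ≃ₗ[K] (Fin 2 → K))
    (hA : ∀ u v, eval (Sum.elim u v) F = eval (Sum.elim (A.symm v) (A u)) F)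
    (z : PP K 2 × PP K 2)
    (hz : z ∈ (fun y : PP K 2 × PP K 2 => (projMap A y.1, y.2)) '' zeroLocus2 {F}) :
    z.swap ∈ (fun y : PP K 2 × PP K 2 => (projMap A y.1, y.2)) '' zeroLocus2 {F} := by
  have hmk : ∀ (B : (Fin 2 → K) ≃ₗ[K] (Fin 2 → K)) (u : Fin 2 → K) (hu : u ≠ 0),
      projMap B (Projectivization.mk K u hu)
        = Projectivization.mk K (B u) (B.map_ne_zero_iff.mpr hu) := fun B u hu =>
    Projectivization.map_mk _ _ _ _
  have hinv : ∀ (B : (Fin 2 → K) ≃ₗ[K] (Fin 2 → K)) (x : PP K 2),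
      projMap B (projMap B.symm x) = x := fun B x => by
    induction x using Projectivization.ind with
    | h v hv => simp [hmk]
  obtain ⟨⟨p, q⟩, hpq, rfl⟩ := hz
  refine ⟨(projMap A.symm q, projMap A p), ?_, by simp [hinv]⟩
  intro P hP u hu v hv hup hvp
  rw [Set.mem_singleton_iff.mp hP, hA]
  refine hpq F rfl _ (A.symm.map_ne_zero_iff.mpr hv) _ (A.map_ne_zero_iff.mpr hu) ?_ ?_
  · rw [← hmk A.symm v hv, hvp]
    exact hinv A.symm p
  · rw [← hmk A u hu, hup]
    exact hinv A q

/-! STATEMENT 16 (Rohn): a nonsingular `(2,2)`-curve `E ⊂ ℙ¹ × ℙ¹` can be made symmetric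
by an automorphism of the first factor. -/

theorem statement_16 (K : Type) [Field K] [IsAlgClosed K] (hchar : ringChar K ≠ 2)
    (F : MvPolynomial (Fin 2 ⊕ Fin 2) K)
    (hbideg : IsBiHomogOf F 2 2) (hirr : Irreducible F)
    -- nonsingularity of `E = {F = 0}` (Jacobian criterion):
    (hsmooth : ∀ (u v : Fin 2 → K), u ≠ 0 → v ≠ 0 →
      eval (Sum.elim u v) F = 0 → ∃ i, eval (Sum.elim u v) (pderiv i F) ≠ 0) :
    -- there is an automorphism `f` of the first ℙ¹ such that the image `E'` of
    -- `E = {F = 0}` under `(p,q) ↦ (f p, q)` is symmetric: `(p,q) ∈ E' → (q,p) ∈ E'`: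
    ∃ A : (Fin 2 → K) ≃ₗ[K] (Fin 2 → K),
      ∀ z : PP K 2 × PP K 2,
        z ∈ ((fun y : PP K 2 × PP K 2 => (projMap A y.1, y.2)) '' zeroLocus2 {F}) →
        Prod.swap z ∈
          ((fun y : PP K 2 × PP K 2 => (projMap A y.1, y.2)) '' zeroLocus2 {F}) := by
  have h2 : (2 : K) ≠ 0 := Ring.two_ne_zero hchar
  have hr : FormSmooth (biCoeff F) := by
    intro u v hu hv h0 h1 h3
    obtain ⟨i, hi⟩ := hsmooth u v hu hv (by rw [hbideg.eval_eq, h0])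
    rcases i with k | k
    · exact hi (by rw [hbideg.eval_pderiv_inl, h1, Pi.zero_apply])
    · exact hi (by rw [hbideg.eval_pderiv_inr, h3, Pi.zero_apply])
  obtain ⟨g, h, hg, hh, hsymm⟩ := hr.exists_symmetric h2
  let G := g.toLinearEquiv' (Matrix.invertibleOfIsUnitDet g hg.isUnit)
  let H := h.toLinearEquiv' (Matrix.invertibleOfIsUnitDet h hh.isUnit)
  have hG : ∀ x, G x = g.mulVec x := fun x => rfl
  have hH : ∀ x, H x = h.mulVec x := fun x => rfl
  refine ⟨G.symm.trans H, swap_mem_image_of_symmetric F _ fun u v => ?_⟩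
  have key := hsymm (G.symm u) (H.symm v)
  simp only [← hG, ← hH, LinearEquiv.apply_symm_apply] at key
  simpa [hbideg.eval_eq] using key

end RQS
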